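/- arXiv:1001.3270 — 5 statements merged into one kernel-verified Lean document; each statement's English description precedes it below -/
import Mathlib

section
/- Let M̄ be an admissible completion as a point set of (M,≪), and let ≪̃ be an admissible chronology on M̄. Assume M̄ is endowed with any topology such that: (i) i(M) is dense in M̄, and (ii) the ≪̃-chronological future and the ≪̃-chronological past of every point of M̄ are open. Then ≪̃ is equal to the extended chronological relation ≪̄. -/
open Filter Set Topology

variable {M : Type*}

/-- The chronological past `I⁻(p)` of a point. -/
def IPast (r : M → M → Prop) (p : M) : Set M := {q | r q p}

/-- The chronological future `I⁺(p)` of a point. -/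
def IFut (r : M → M → Prop) (p : M) : Set M := {q | r p q}

/-- The chronological past `I⁻[S]` of a set. -/
def IPastS (r : M → M → Prop) (S : Set M) : Set M := ⋃ s ∈ S, IPast r s

/-- The chronological future `I⁺[S]` of a set. -/
def IFutS (r : M → M → Prop) (S : Set M) : Set M := ⋃ s ∈ S, IFut r s

/-- A past set: `P = I⁻[P]`. -/
def IsPastSet (r : M → M → Prop) (P : Set M) : Prop := P = IPastS r P

/-- A future set: `F = I⁺[F]`. -/
def IsFutSet (r : M → M → Prop) (F : Set M) : Prop := F = IFutS r F

/-- An indecomposable past set (IP). -/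
def IsIP (r : M → M → Prop) (P : Set M) : Prop :=
  P.Nonempty ∧ IsPastSet r P ∧
    ¬∃ P₁ P₂ : Set M, IsPastSet r P₁ ∧ IsPastSet r P₂ ∧ P₁ ⊂ P ∧ P₂ ⊂ P ∧ P = P₁ ∪ P₂

/-- An indecomposable future set (IF). -/
def IsIF (r : M → M → Prop) (F : Set M) : Prop :=
  F.Nonempty ∧ IsFutSet r F ∧
    ¬∃ F₁ F₂ : Set M, IsFutSet r F₁ ∧ IsFutSet r F₂ ∧ F₁ ⊂ F ∧ F₂ ⊂ F ∧ F = F₁ ∪ F₂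

/-- A terminal IP (TIP): an IP which is not of the form `I⁻(p)`. -/
def IsTIP (r : M → M → Prop) (P : Set M) : Prop := IsIP r P ∧ ∀ p : M, P ≠ IPast r p

/-- A terminal IF (TIF). -/
def IsTIF (r : M → M → Prop) (F : Set M) : Prop := IsIF r F ∧ ∀ p : M, F ≠ IFut r p

/-- The common future `↑P`. -/
def commonFut (r : M → M → Prop) (P : Set M) : Set M := IFutS r {q | ∀ p ∈ P, r p q}

/-- The common past `↓F`. -/
def commonPast (r : M → M → Prop) (F : Set M) : Set M := IPastS r {q | ∀ p ∈ F, r q p}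

/-- `P` is a maximal IP contained in `S`. -/
def MaxIPIn (r : M → M → Prop) (P S : Set M) : Prop :=
  IsIP r P ∧ P ⊆ S ∧ ∀ P', IsIP r P' → P' ⊆ S → P ⊆ P' → P = P'

/-- `F` is a maximal IF contained in `S`. -/
def MaxIFIn (r : M → M → Prop) (F S : Set M) : Prop :=
  IsIF r F ∧ F ⊆ S ∧ ∀ F', IsIF r F' → F' ⊆ S → F ⊆ F' → F = F'

/-- The Szabados relation between (nonempty) indecomposable sets: `F` is a maximal IF
contained in `↑P` and `P` is a maximal IP contained in `↓F`. -/
def SRelNE (r : M → M → Prop) (P F : Set M) : Prop :=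
  MaxIFIn r F (commonFut r P) ∧ MaxIPIn r P (commonPast r F)

/-- The full S-relation, allowing one empty component. -/
def SRel (r : M → M → Prop) (P F : Set M) : Prop :=
  SRelNE r P F ∨
    (F = ∅ ∧ IsIP r P ∧ ∀ F', IsIF r F' → ¬SRelNE r P F') ∨
    (P = ∅ ∧ IsIF r F ∧ ∀ P', IsIP r P' → ¬SRelNE r P' F)

/-- The embedding `i(p) = (I⁻(p), I⁺(p))`. -/
def chrEmb (r : M → M → Prop) (p : M) : Set M × Set M := (IPast r p, IFut r p)

/-- The image `i(M)` inside the set of pairs. -/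
def imgM (r : M → M → Prop) : Set (Set M × Set M) := Set.range (chrEmb r)

/-- An admissible completion as a point set. -/
structure IsAdmissibleCompletion (r : M → M → Prop) (Mb : Set (Set M × Set M)) : Prop where
  mem_point : ∀ p : M, chrEmb r p ∈ Mb
  complete_TIP : ∀ P : Set M, IsTIP r P → ∃ x ∈ Mb \ imgM r, x.1 = P
  complete_TIF : ∀ F : Set M, IsTIF r F → ∃ x ∈ Mb \ imgM r, x.2 = F
  srel : ∀ x ∈ Mb, SRel r x.1 x.2

/-- The extended chronological relation `(P,F) ≪̄ (P',F') ↔ F ∩ P' ≠ ∅`. -/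
def extChron (x y : Set M × Set M) : Prop := (x.2 ∩ y.1).Nonempty

/-- A chronology: a transitive and anti-reflexive binary relation. -/
def IsChronology (r : M → M → Prop) : Prop := Transitive r ∧ Irreflexive r

/-- A chronological set: a chronology with no isolates which is chronologically separable. -/
def IsChronologicalSet (r : M → M → Prop) : Prop :=
  IsChronology r ∧ (∀ x, ∃ y, r x y ∨ r y x) ∧
    ∃ S : Set M, S.Countable ∧ ∀ x y, r x y → ∃ s ∈ S, r x s ∧ r s y
/-- An extended chronology on the completion: a relation making it a chronological set and
containing the original chronology and the relations defining the boundary points. -/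
def IsExtendedChronology (r : M → M → Prop) (Mb : Set (Set M × Set M))
    (hMb : IsAdmissibleCompletion r Mb) (rt : ↥Mb → ↥Mb → Prop) : Prop :=
  IsChronologicalSet rt ∧
    (∀ (p : M) (x : ↥Mb), p ∈ (x : Set M × Set M).1 → rt ⟨chrEmb r p, hMb.mem_point p⟩ x) ∧
    (∀ (q : M) (x : ↥Mb), q ∈ (x : Set M × Set M).2 → rt x ⟨chrEmb r q, hMb.mem_point q⟩)

/-- An admissible chronology on the completion: an extended chronology introducing no new
relations between a point of `M` and a point of `M̄`. -/
def IsAdmissibleChronology (r : M → M → Prop) (Mb : Set (Set M × Set M))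
    (hMb : IsAdmissibleCompletion r Mb) (rt : ↥Mb → ↥Mb → Prop) : Prop :=
  IsExtendedChronology r Mb hMb rt ∧
    ∀ x : ↥Mb, {p : M | rt ⟨chrEmb r p, hMb.mem_point p⟩ x} = (x : Set M × Set M).1 ∧
      {q : M | rt x ⟨chrEmb r q, hMb.mem_point q⟩} = (x : Set M × Set M).2

/-- **Theorem.** Let `M̄` be an admissible completion as a point set of `(M,≪)` and `≪̃` an
admissible chronology on `M̄`. If `M̄` carries a topology for which (i) `i(M)` is dense in `M̄`
and (ii) the `≪̃`-chronological future and past of every point are open, then `≪̃` coincides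
with the extended chronological relation `≪̄`. -/
theorem admissible_chronology_eq_extChron
    (r : M → M → Prop) (hr : IsChronology r)
    (Mb : Set (Set M × Set M)) (hMb : IsAdmissibleCompletion r Mb)
    (rt : ↥Mb → ↥Mb → Prop) (hrt : IsAdmissibleChronology r Mb hMb rt)
    (τ : TopologicalSpace ↥Mb)
    (hdense : @Dense ↥Mb τ {x : ↥Mb | (x : Set M × Set M) ∈ imgM r})
    (hopen : ∀ x : ↥Mb, IsOpen[τ] {y : ↥Mb | rt x y} ∧ IsOpen[τ] {y : ↥Mb | rt y x}) :
    ∀ x y : ↥Mb, rt x y ↔ extChron (x : Set M × Set M) (y : Set M × Set M) := by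
  obtain ⟨⟨⟨⟨htrans, -⟩, -, S, -, hS⟩, hpast, hfut⟩, hadm⟩ := hrt
  intro x y
  constructor
  · intro hxy
    obtain ⟨z, -, hxz, hzy⟩ := hS x y hxy
    obtain ⟨w, ⟨hxw, hwy⟩, hw⟩ :=
      hdense.inter_open_nonempty _ ((hopen x).1.inter (hopen y).2) ⟨z, hxz, hzy⟩
    obtain ⟨m, hm⟩ := hw
    obtain rfl : ⟨chrEmb r m, hMb.mem_point m⟩ = w := Subtype.ext hm
    exact ⟨m, (hadm x).2.subset hxw, (hadm y).1.subset hwy⟩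
  · rintro ⟨m, hmx, hmy⟩
    exact htrans (hfut m x hmx) (hpast m y hmy)
end

section
/- Let M̄ be an admissible completion as a point set of (M,≪), endowed with a topology τ. (a) If I⁺((P,F)) and I⁻((P,F)) (computed with ≪̄) are τ-open for every (P,F) ∈ M̄, then whenever a sequence ((P_n,F_n)) in M̄ τ-converges to (P,F) one has P ⊆ LI(P_n) and F ⊆ LI(F_n). (b) Conversely, if τ is sequential and every τ-convergent sequence ((P_n,F_n)) → (P,F) satisfies P ⊆ LI(P_n) and F ⊆ LI(F_n), then I⁺((P,F)) and I⁻((P,F)) are τ-open for every (P,F) ∈ M̄; in particular, I⁺(i(p)) and I⁻(i(p)) are open in M̄ for every p ∈ M. -/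
open Filter Set Topology

variable {M : Type*}

/-- The chronological future of a point of the completion, inside the completion,
with respect to the extended chronological relation. -/
def futIn (Mb : Set (Set M × Set M)) (x : ↥Mb) : Set ↥Mb :=
  {y | extChron (x : Set M × Set M) (y : Set M × Set M)}

/-- The chronological past of a point of the completion, inside the completion. -/
def pastIn (Mb : Set (Set M × Set M)) (x : ↥Mb) : Set ↥Mb :=
  {y | extChron (y : Set M × Set M) (x : Set M × Set M)}

/-- CEAT: the coarsest topology on the completion in which all the sets `I⁺((P,F))`
and `I⁻((P,F))` are open. -/
def CEAT (Mb : Set (Set M × Set M)) : TopologicalSpace ↥Mb :=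
  TopologicalSpace.generateFrom
    ({S | ∃ x : ↥Mb, S = futIn Mb x} ∪ {S | ∃ x : ↥Mb, S = pastIn Mb x})

/-- The set-theoretic inferior limit of a sequence of sets. -/
def setLI (A : ℕ → Set M) : Set M := {x | ∀ᶠ n in Filter.atTop, x ∈ A n}

/-- The set-theoretic superior limit of a sequence of sets. -/
def setLS (A : ℕ → Set M) : Set M := {x | ∃ᶠ n in Filter.atTop, x ∈ A n}

/-- The chronological limit operator (on pairs). -/
def chrLim (r : M → M → Prop) (σ : ℕ → Set M × Set M) (x : Set M × Set M) : Prop :=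
  (x.1 ≠ ∅ → x.1 ⊆ setLI (fun n => (σ n).1) ∧ MaxIPIn r x.1 (setLS fun n => (σ n).1)) ∧
  (x.2 ≠ ∅ → x.2 ⊆ setLI (fun n => (σ n).2) ∧ MaxIFIn r x.2 (setLS fun n => (σ n).2))

/-- The topology derived from a limit operator: closed sets are those containing all the
`L`-limits of their sequences. -/
def derivedTop {X : Type*} (L : (ℕ → X) → Set X)
    (hL : ∀ (σ : ℕ → X) (φ : ℕ → ℕ), StrictMono φ → L σ ⊆ L (σ ∘ φ)) :
    TopologicalSpace X where
  IsOpen U := ∀ σ : ℕ → X, (∀ n, σ n ∈ Uᶜ) → L σ ⊆ Uᶜ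
  isOpen_univ := by
    intro σ h
    simpa using h 0
  isOpen_inter := by
    intro U V hU hV σ hσ x hx
    have h : ∀ n, σ n ∈ Uᶜ ∨ σ n ∈ Vᶜ := by
      intro n
      have h' := hσ n
      rw [Set.compl_inter] at h'
      exact h'
    have hfreq : (∃ᶠ n in Filter.atTop, σ n ∈ Uᶜ) ∨ ∃ᶠ n in Filter.atTop, σ n ∈ Vᶜ :=
      Filter.frequently_or_distrib.mp (Filter.Frequently.of_forall h)
    rw [Set.compl_inter]
    rcases hfreq with hf | hf
    · obtain ⟨φ, hφ, hmem⟩ := Filter.extraction_of_frequently_atTop hf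
      exact Or.inl (hU (σ ∘ φ) hmem (hL σ φ hφ hx))
    · obtain ⟨φ, hφ, hmem⟩ := Filter.extraction_of_frequently_atTop hf
      exact Or.inr (hV (σ ∘ φ) hmem (hL σ φ hφ hx))
  isOpen_sUnion := by
    intro S hS σ hσ x hx
    intro hmem
    rcases hmem with ⟨U, hU, hxU⟩
    exact hS U hU σ (fun n h => hσ n ⟨U, hU, h⟩) hx hxU

lemma setLI_subseq {A : ℕ → Set M} {φ : ℕ → ℕ} (hφ : StrictMono φ) :
    setLI A ⊆ setLI fun n => A (φ n) :=
  fun _ hx => hφ.tendsto_atTop.eventually hx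

lemma setLS_subseq {A : ℕ → Set M} {φ : ℕ → ℕ} (hφ : StrictMono φ) :
    (setLS fun n => A (φ n)) ⊆ setLS A :=
  fun _ hx => hφ.tendsto_atTop.frequently hx

/-- The chronological limit operator on the completion. -/
def chrL (r : M → M → Prop) (Mb : Set (Set M × Set M)) (σ : ℕ → ↥Mb) : Set ↥Mb :=
  {x | chrLim r (fun n => ((σ n : Set M × Set M))) (x : Set M × Set M)}

lemma chrL_subseq (r : M → M → Prop) (Mb : Set (Set M × Set M)) :
    ∀ (σ : ℕ → ↥Mb) (φ : ℕ → ℕ), StrictMono φ → chrL r Mb σ ⊆ chrL r Mb (σ ∘ φ) := by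
  intro σ φ hφ x hx
  obtain ⟨h1, h2⟩ := hx
  constructor
  · intro hne
    obtain ⟨hli, hmax⟩ := h1 hne
    exact ⟨fun y hy => setLI_subseq hφ (hli hy), hmax.1,
      fun y hy => Filter.Eventually.frequently (setLI_subseq hφ (hli hy)),
      fun P' hP' hP'sub hsub => hmax.2.2 P' hP' (fun y hy => setLS_subseq hφ (hP'sub hy)) hsub⟩
  · intro hne
    obtain ⟨hli, hmax⟩ := h2 hne
    exact ⟨fun y hy => setLI_subseq hφ (hli hy), hmax.1,
      fun y hy => Filter.Eventually.frequently (setLI_subseq hφ (hli hy)),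
      fun F' hF' hF'sub hsub => hmax.2.2 F' hF' (fun y hy => setLS_subseq hφ (hF'sub hy)) hsub⟩

/-- The chronological topology on the completion. -/
def chrTop (r : M → M → Prop) (Mb : Set (Set M × Set M)) : TopologicalSpace ↥Mb :=
  derivedTop (chrL r Mb) (chrL_subseq r Mb)

/-- Admissibility condition (A1): chronological futures and pasts are open. -/
def CondA1 (Mb : Set (Set M × Set M)) (τ : TopologicalSpace ↥Mb) : Prop :=
  ∀ x : ↥Mb, IsOpen[τ] (futIn Mb x) ∧ IsOpen[τ] (pastIn Mb x)

/-- Admissibility condition (A2). -/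
def CondA2 (Mb : Set (Set M × Set M)) (τ : TopologicalSpace ↥Mb) : Prop :=
  (∀ (σ : ℕ → ↥Mb) (x : ↥Mb), Filter.Tendsto σ Filter.atTop (@nhds _ τ x) →
      (x : Set M × Set M).2 = ∅ →
      ∀ y : ↥Mb, (x : Set M × Set M).1 ⊆ (y : Set M × Set M).1 →
        (y : Set M × Set M).1 ⊆ setLI (fun n => ((σ n : Set M × Set M)).1) → y = x) ∧
  (∀ (σ : ℕ → ↥Mb) (x : ↥Mb), Filter.Tendsto σ Filter.atTop (@nhds _ τ x) →
      (x : Set M × Set M).1 = ∅ →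
      ∀ y : ↥Mb, (x : Set M × Set M).2 ⊆ (y : Set M × Set M).2 →
        (y : Set M × Set M).2 ⊆ setLI (fun n => ((σ n : Set M × Set M)).2) → y = x)

/-- Admissibility condition (A3): maximal coarseness among (A1)∧(A2) topologies. -/
def CondA3 (Mb : Set (Set M × Set M)) (τ : TopologicalSpace ↥Mb) : Prop :=
  ∀ τ' : TopologicalSpace ↥Mb, CondA1 Mb τ' → CondA2 Mb τ' → ¬(τ < τ')

lemma SRel.isPastSet {r : M → M → Prop} {P F : Set M} (h : SRel r P F) : IsPastSet r P := by
  rcases h with h | ⟨_, h, _⟩ | ⟨rfl, _, _⟩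
  · exact h.2.1.2.1
  · exact h.2.1
  · simp [IsPastSet, IPastS]

lemma SRel.isFutSet {r : M → M → Prop} {P F : Set M} (h : SRel r P F) : IsFutSet r F := by
  rcases h with h | ⟨rfl, _, _⟩ | ⟨_, h, _⟩
  · exact h.1.1.2.1
  · simp [IsFutSet, IFutS]
  · exact h.2.1

lemma IsPastSet.mem_iff {r : M → M → Prop} {P : Set M} (h : IsPastSet r P) {p : M} :
    p ∈ P ↔ ∃ q ∈ P, r p q := by
  conv_lhs => rw [h]
  simp [IPastS, IPast]

lemma IsFutSet.mem_iff {r : M → M → Prop} {F : Set M} (h : IsFutSet r F) {p : M} :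
    p ∈ F ↔ ∃ q ∈ F, r q p := by
  conv_lhs => rw [h]
  simp [IFutS, IFut]

/-- In a sequential space, a set is open as soon as every sequence converging to one of its
points is eventually in it. -/
lemma isOpen_of_forall_seq_eventually_mem {X : Type*} [TopologicalSpace X] [SequentialSpace X]
    {U : Set X} (h : ∀ (σ : ℕ → X), ∀ x ∈ U, Tendsto σ atTop (𝓝 x) → ∀ᶠ n in atTop, σ n ∈ U) :
    IsOpen U := by
  rw [← isClosed_compl_iff]
  refine IsSeqClosed.isClosed fun σ x hσ hx hxU => ?_
  obtain ⟨n, hn⟩ := (h σ x hxU hx).exists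
  exact hσ n hn

/-- **Lemma.** Let `M̄` be an admissible completion as a point set of `(M,≪)` with a topology
`τ`. (a) If all the sets `I⁺((P,F))`, `I⁻((P,F))` (computed with `≪̄`) are `τ`-open, then any
`τ`-convergent sequence `(Pₙ,Fₙ) → (P,F)` satisfies `P ⊆ LI(Pₙ)` and `F ⊆ LI(Fₙ)`.
(b) Conversely, if `τ` is sequential and every `τ`-convergent sequence satisfies those
inclusions, then all the sets `I⁺((P,F))`, `I⁻((P,F))` are `τ`-open; in particular
`I⁺(i(p))` and `I⁻(i(p))` are open for every `p ∈ M`. -/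
theorem open_futures_iff_LI_of_sequential
    (r : M → M → Prop) (hr : IsChronology r)
    (Mb : Set (Set M × Set M)) (hMb : IsAdmissibleCompletion r Mb)
    (τ : TopologicalSpace ↥Mb) :
    ((∀ x : ↥Mb, IsOpen[τ] (futIn Mb x) ∧ IsOpen[τ] (pastIn Mb x)) →
      ∀ (σ : ℕ → ↥Mb) (x : ↥Mb), Filter.Tendsto σ Filter.atTop (@nhds _ τ x) →
        (x : Set M × Set M).1 ⊆ setLI (fun n => ((σ n : Set M × Set M)).1) ∧
        (x : Set M × Set M).2 ⊆ setLI (fun n => ((σ n : Set M × Set M)).2)) ∧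
    (@SequentialSpace ↥Mb τ →
      (∀ (σ : ℕ → ↥Mb) (x : ↥Mb), Filter.Tendsto σ Filter.atTop (@nhds _ τ x) →
        (x : Set M × Set M).1 ⊆ setLI (fun n => ((σ n : Set M × Set M)).1) ∧
        (x : Set M × Set M).2 ⊆ setLI (fun n => ((σ n : Set M × Set M)).2)) →
      (∀ x : ↥Mb, IsOpen[τ] (futIn Mb x) ∧ IsOpen[τ] (pastIn Mb x)) ∧
      (∀ p : M, IsOpen[τ] (futIn Mb ⟨chrEmb r p, hMb.mem_point p⟩) ∧
        IsOpen[τ] (pastIn Mb ⟨chrEmb r p, hMb.mem_point p⟩))) := by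
  refine ⟨fun hopen σ x hσ => ⟨fun p hp => ?_, fun p hp => ?_⟩, fun hseq hLI => ?_⟩
  · obtain ⟨q, hq, hpq⟩ := (hMb.srel x x.2).isPastSet.mem_iff.1 hp
    refine (hσ.eventually ((hopen ⟨chrEmb r p, hMb.mem_point p⟩).1.mem_nhds
      (show x ∈ futIn Mb _ from ⟨q, hpq, hq⟩))).mono ?_
    rintro n ⟨s, hps, hs⟩
    exact (hMb.srel _ (σ n).2).isPastSet.mem_iff.2 ⟨s, hs, hps⟩
  · obtain ⟨q, hq, hqp⟩ := (hMb.srel x x.2).isFutSet.mem_iff.1 hp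
    refine (hσ.eventually ((hopen ⟨chrEmb r p, hMb.mem_point p⟩).2.mem_nhds
      (show x ∈ pastIn Mb _ from ⟨q, hq, hqp⟩))).mono ?_
    rintro n ⟨s, hs, hsp⟩
    exact (hMb.srel _ (σ n).2).isFutSet.mem_iff.2 ⟨s, hs, hsp⟩
  · have hopen : ∀ x : ↥Mb, IsOpen[τ] (futIn Mb x) ∧ IsOpen[τ] (pastIn Mb x) := by
      refine fun x => ⟨isOpen_of_forall_seq_eventually_mem ?_,
        isOpen_of_forall_seq_eventually_mem ?_⟩
      · rintro σ y ⟨q, hqx, hqy⟩ hσ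
        exact ((hLI σ y hσ).1 hqy).mono fun n hn => ⟨q, hqx, hn⟩
      · rintro σ y ⟨q, hqy, hqx⟩ hσ
        exact ((hLI σ y hσ).2 hqy).mono fun n hn => ⟨q, hn, hqx⟩
    exact ⟨hopen, fun p => hopen _⟩
end

section
/- Let M̄ be an admissible completion as a point set of (M,≪) and let (P,F) ∈ M̄ with P ≠ ∅ ≠ F. A sequence ((P_n,F_n)) in M̄ converges to (P,F) in CEAT if and only if it converges to (P,F) in the chr. topology; equivalently, if and only if P ∈ L̂(P_n) and F ∈ Ľ(F_n). -/
open Filter Set Topology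

variable {M : Type*}

lemma IsPastSet.empty (r : M → M → Prop) : IsPastSet r ∅ := by
  simp [IsPastSet, IPastS]

lemma IsPastSet.mem_of_rel {r : M → M → Prop} {P : Set M} (hP : IsPastSet r P) {p q : M}
    (hpq : r p q) (hq : q ∈ P) : p ∈ P := by
  rw [hP]
  exact mem_biUnion hq hpq

lemma IsPastSet.exists_rel {r : M → M → Prop} {P : Set M} (hP : IsPastSet r P) {p : M}
    (hp : p ∈ P) : ∃ q ∈ P, r p q := by
  rw [hP] at hp
  simpa [IPastS, IPast] using hp

lemma SRelNE.flip {r : M → M → Prop} {P F : Set M} (h : SRelNE r P F) :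
    SRelNE (flip r) F P :=
  ⟨h.2, h.1⟩

lemma SRelNE.rel {r : M → M → Prop} (hr : Transitive r) {P F : Set M} (h : SRelNE r P F)
    {p f : M} (hp : p ∈ P) (hf : f ∈ F) : r p f := by
  have hp' := h.2.2.1 hp
  simp only [commonPast, IPastS, IPast, mem_iUnion, mem_ofPred_eq] at hp'
  obtain ⟨q, hq, hpq⟩ := hp'
  exact hr hpq (hq f hf)

lemma SRel.flip {r : M → M → Prop} {P F : Set M} (h : SRel r P F) : SRel (flip r) F P := by
  rcases h with h | ⟨hF, hP, h⟩ | ⟨hP, hF, h⟩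
  · exact Or.inl h.flip
  · exact Or.inr (Or.inr ⟨hF, hP, fun F' hF' h' => h F' hF' h'.flip⟩)
  · exact Or.inr (Or.inl ⟨hP, hF, fun P' hP' h' => h P' hP' h'.flip⟩)

lemma SRel.sRelNE {r : M → M → Prop} {P F : Set M} (h : SRel r P F)
    (hP : P.Nonempty) (hF : F.Nonempty) : SRelNE r P F := by
  rcases h with h | h | h
  · exact h
  · exact absurd h.1 hF.ne_empty
  · exact absurd h.1 hP.ne_empty

lemma SRel.rel {r : M → M → Prop} (hr : Transitive r) {P F : Set M} (h : SRel r P F)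
    {p f : M} (hp : p ∈ P) (hf : f ∈ F) : r p f :=
  (h.sRelNE ⟨p, hp⟩ ⟨f, hf⟩).rel hr hp hf

lemma IsPastSet.subset_setLI {r : M → M → Prop} {P : Set M} {A : ℕ → Set M}
    (hP : IsPastSet r P) (hA : ∀ n, IsPastSet r (A n))
    (h : ∀ p, (IFut r p ∩ P).Nonempty → ∀ᶠ n in atTop, (IFut r p ∩ A n).Nonempty) :
    P ⊆ setLI A := by
  intro p hp
  obtain ⟨q, hq, hpq⟩ := hP.exists_rel hp
  filter_upwards [h p ⟨q, hpq, hq⟩] with n ⟨a, hpa, ha⟩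
  exact (hA n).mem_of_rel hpa ha

lemma SRelNE.maxIPIn_setLS {r : M → M → Prop} {P F : Set M} {A B : ℕ → Set M}
    (h : SRelNE r P F) (hP : P ⊆ setLI A) (hF : F ⊆ setLI B)
    (hAB : ∀ n, ∀ a ∈ A n, ∀ b ∈ B n, r a b) : MaxIPIn r P (setLS A) := by
  refine ⟨h.2.1, fun p hp => (hP hp).frequently, fun P' hP' hP'A hPP' => ?_⟩
  refine h.2.2.2 P' hP' (fun p hp => ?_) hPP'
  obtain ⟨q, hq, hpq⟩ := hP'.2.1.exists_rel hp
  refine mem_biUnion (x := q) (fun f hf => ?_) hpq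
  obtain ⟨n, ha, hb⟩ := ((hP'A hq).and_eventually (hF hf)).exists
  exact hAB n q ha f hb

lemma tendsto_CEAT_iff {Mb : Set (Set M × Set M)} {σ : ℕ → ↥Mb} {x : ↥Mb} :
    Tendsto σ atTop (@nhds _ (CEAT Mb) x) ↔
      (∀ y, x ∈ futIn Mb y → ∀ᶠ n in atTop, σ n ∈ futIn Mb y) ∧
        ∀ y, x ∈ pastIn Mb y → ∀ᶠ n in atTop, σ n ∈ pastIn Mb y := by
  rw [CEAT, TopologicalSpace.tendsto_nhds_generateFrom_iff]
  constructor
  · exact fun h => ⟨fun y hy => h _ (Or.inl ⟨y, rfl⟩) hy, fun y hy => h _ (Or.inr ⟨y, rfl⟩) hy⟩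
  · rintro ⟨h₁, h₂⟩ _ (⟨y, rfl⟩ | ⟨y, rfl⟩) hy
    exacts [h₁ y hy, h₂ y hy]

lemma tendsto_derivedTop {X : Type*} {L : (ℕ → X) → Set X}
    (hL : ∀ (σ : ℕ → X) (φ : ℕ → ℕ), StrictMono φ → L σ ⊆ L (σ ∘ φ))
    {σ : ℕ → X} {x : X} (hx : x ∈ L σ) :
    Tendsto σ atTop (@nhds _ (derivedTop L hL) x) := by
  let := derivedTop L hL
  refine tendsto_nhds.2 fun U hU hxU => ?_
  by_contra h
  obtain ⟨φ, hφ, hmem⟩ := extraction_of_frequently_atTop (not_eventually.1 h)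
  exact hU (σ ∘ φ) hmem (hL σ φ hφ hx) hxU

lemma chrTop_le_CEAT (r : M → M → Prop) (Mb : Set (Set M × Set M)) :
    chrTop r Mb ≤ CEAT Mb := by
  refine le_generateFrom ?_
  rintro _ (⟨y, rfl⟩ | ⟨y, rfl⟩) <;> rintro σ hσ z hz ⟨q, hq₁, hq₂⟩
  · obtain ⟨n, hn⟩ := ((hz.1 (nonempty_of_mem hq₂).ne_empty).1 hq₂).exists
    exact hσ n ⟨q, hq₁, hn⟩
  · obtain ⟨n, hn⟩ := ((hz.2 (nonempty_of_mem hq₁).ne_empty).1 hq₁).exists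
    exact hσ n ⟨q, hn, hq₂⟩

/-- **Proposition.** Let `(P,F) ∈ M̄` with `P ≠ ∅ ≠ F`. A sequence `((Pₙ,Fₙ))` in `M̄`
converges to `(P,F)` with CEAT iff it converges with the chr. topology, and iff
`P ∈ L̂(Pₙ)` and `F ∈ Ľ(Fₙ)`. -/
theorem CEAT_conv_iff_chr_conv_of_nonempty
    (r : M → M → Prop) (hr : IsChronology r)
    (Mb : Set (Set M × Set M)) (hMb : IsAdmissibleCompletion r Mb)
    (x : ↥Mb) (hP : (x : Set M × Set M).1.Nonempty) (hF : (x : Set M × Set M).2.Nonempty)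
    (σ : ℕ → ↥Mb) :
    (Filter.Tendsto σ Filter.atTop (@nhds _ (CEAT Mb) x) ↔
      Filter.Tendsto σ Filter.atTop (@nhds _ (chrTop r Mb) x)) ∧
    (Filter.Tendsto σ Filter.atTop (@nhds _ (CEAT Mb) x) ↔
      (((x : Set M × Set M).1 ⊆ setLI fun n => ((σ n : Set M × Set M)).1) ∧
        MaxIPIn r (x : Set M × Set M).1 (setLS fun n => ((σ n : Set M × Set M)).1) ∧
        ((x : Set M × Set M).2 ⊆ setLI fun n => ((σ n : Set M × Set M)).2) ∧
        MaxIFIn r (x : Set M × Set M).2 (setLS fun n => ((σ n : Set M × Set M)).2))) := by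
  have key : Tendsto σ atTop (@nhds _ (CEAT Mb) x) ↔
      (((x : Set M × Set M).1 ⊆ setLI fun n => ((σ n : Set M × Set M)).1) ∧
        MaxIPIn r (x : Set M × Set M).1 (setLS fun n => ((σ n : Set M × Set M)).1) ∧
        ((x : Set M × Set M).2 ⊆ setLI fun n => ((σ n : Set M × Set M)).2) ∧
        MaxIFIn r (x : Set M × Set M).2 (setLS fun n => ((σ n : Set M × Set M)).2)) := by
    rw [tendsto_CEAT_iff]
    constructor
    · rintro ⟨hfut, hpast⟩
      have hx := hMb.srel x x.2
      have hσ n := hMb.srel (σ n) (σ n).2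
      have hLP : (x : Set M × Set M).1 ⊆ setLI fun n => (σ n : Set M × Set M).1 :=
        hx.isPastSet.subset_setLI (fun n => (hσ n).isPastSet)
          fun p hp => hfut ⟨_, hMb.mem_point p⟩ hp
      have hLF : (x : Set M × Set M).2 ⊆ setLI fun n => (σ n : Set M × Set M).2 := by
        refine hx.flip.isPastSet.subset_setLI (fun n => (hσ n).flip.isPastSet) fun p hp => ?_
        rw [inter_comm] at hp
        filter_upwards [hpast ⟨_, hMb.mem_point p⟩ hp] with n hn
        rw [inter_comm]
        exact hn
      have hxNE := hx.sRelNE hP hF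
      exact ⟨hLP, hxNE.maxIPIn_setLS hLP hLF fun n _ ha _ hb => (hσ n).rel hr.1 ha hb, hLF,
        hxNE.flip.maxIPIn_setLS hLF hLP fun n _ hb _ ha => (hσ n).rel hr.1 ha hb⟩
    · rintro ⟨hLP, -, hLF, -⟩
      refine ⟨fun y ⟨q, hq₁, hq₂⟩ => ?_, fun y ⟨q, hq₁, hq₂⟩ => ?_⟩
      · filter_upwards [hLP hq₂] with n hn using ⟨q, hq₁, hn⟩
      · filter_upwards [hLF hq₁] with n hn using ⟨q, hn, hq₂⟩
  refine ⟨⟨fun h => ?_, fun h => h.mono_right (nhds_mono (chrTop_le_CEAT r Mb))⟩, key⟩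
  obtain ⟨hLP, hmP, hLF, hmF⟩ := key.1 h
  exact tendsto_derivedTop (chrL_subseq r Mb) ⟨fun _ => ⟨hLP, hmP⟩, fun _ => ⟨hLF, hmF⟩⟩
end

section
/- Let M̄ be an admissible completion as a point set of (M,≪), endowed with the chr. topology. If a sequence ((P_n,F_n)) in M̄ converges to (P,F) in the chr. topology, then P ⊆ LI(P_n) and F ⊆ LI(F_n). Consequently, I⁺((P,F)) and I⁻((P,F)) (computed with ≪̄) are open in the chr. topology for every (P,F) ∈ M̄; in particular the chr. topology is finer than CEAT. -/
open Filter Set Topology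

variable {M : Type*}

lemma isOpen_setOf_mem_fst (r : M → M → Prop) (Mb : Set (Set M × Set M)) (q : M) :
    IsOpen[chrTop r Mb] {y : ↥Mb | q ∈ (y : Set M × Set M).1} := by
  intro σ hσ x hx hq
  obtain ⟨n, hn⟩ := ((hx.1 fun h => (Set.ext_iff.mp h q).mp hq).1 hq).exists
  exact hσ n hn

lemma isOpen_setOf_mem_snd (r : M → M → Prop) (Mb : Set (Set M × Set M)) (q : M) :
    IsOpen[chrTop r Mb] {y : ↥Mb | q ∈ (y : Set M × Set M).2} := by
  intro σ hσ x hx hq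
  obtain ⟨n, hn⟩ := ((hx.2 fun h => (Set.ext_iff.mp h q).mp hq).1 hq).exists
  exact hσ n hn

lemma isOpen_futIn (r : M → M → Prop) (Mb : Set (Set M × Set M)) (x : ↥Mb) :
    IsOpen[chrTop r Mb] (futIn Mb x) := by
  let _ := chrTop r Mb
  have h : futIn Mb x =
      ⋃ q ∈ (x : Set M × Set M).2, {y : ↥Mb | q ∈ (y : Set M × Set M).1} := by
    ext y
    simp [futIn, extChron, Set.Nonempty]
  rw [h]
  exact isOpen_biUnion fun q _ => isOpen_setOf_mem_fst r Mb q

lemma isOpen_pastIn (r : M → M → Prop) (Mb : Set (Set M × Set M)) (x : ↥Mb) :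
    IsOpen[chrTop r Mb] (pastIn Mb x) := by
  let _ := chrTop r Mb
  have h : pastIn Mb x =
      ⋃ q ∈ (x : Set M × Set M).1, {y : ↥Mb | q ∈ (y : Set M × Set M).2} := by
    ext y
    simp [pastIn, extChron, Set.Nonempty, and_comm]
  rw [h]
  exact isOpen_biUnion fun q _ => isOpen_setOf_mem_snd r Mb q

/-- **Lemma.** If a sequence `((Pₙ,Fₙ))` converges to `(P,F)` with the chr. topology, then
`P ⊆ LI(Pₙ)` and `F ⊆ LI(Fₙ)`. Consequently the sets `I⁺((P,F))` and `I⁻((P,F))` are open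
in the chr. topology, and the chr. topology is finer than CEAT. -/
theorem chrTop_finer_CEAT
    (r : M → M → Prop) (hr : IsChronology r)
    (Mb : Set (Set M × Set M)) (hMb : IsAdmissibleCompletion r Mb) :
    (∀ (σ : ℕ → ↥Mb) (x : ↥Mb),
      Filter.Tendsto σ Filter.atTop (@nhds _ (chrTop r Mb) x) →
        ((x : Set M × Set M).1 ⊆ setLI fun n => ((σ n : Set M × Set M)).1) ∧
        ((x : Set M × Set M).2 ⊆ setLI fun n => ((σ n : Set M × Set M)).2)) ∧
    (∀ x : ↥Mb, IsOpen[chrTop r Mb] (futIn Mb x) ∧ IsOpen[chrTop r Mb] (pastIn Mb x)) ∧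
    chrTop r Mb ≤ CEAT Mb := by
  let _ := chrTop r Mb
  refine ⟨fun σ x hσ => ⟨fun q hq => ?_, fun q hq => ?_⟩,
    fun x => ⟨isOpen_futIn r Mb x, isOpen_pastIn r Mb x⟩, le_generateFrom ?_⟩
  · exact hσ.eventually ((isOpen_setOf_mem_fst r Mb q).mem_nhds hq)
  · exact hσ.eventually ((isOpen_setOf_mem_snd r Mb q).mem_nhds hq)
  · rintro _ (⟨x, rfl⟩ | ⟨x, rfl⟩)
    · exact isOpen_futIn r Mb x
    · exact isOpen_pastIn r Mb x
end

section
/- Let X be a set endowed with a limit operator L and let τ_L be the derived topology. Then: (i) if x ∈ L(σ) for a sequence σ in X, then σ converges to x in τ_L; (ii) (X, τ_L) is a sequential space. -/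
open Filter Set Topology

/-- Every `L`-limit of a sequence is a limit of that sequence in the derived topology. -/
theorem tendsto_derivedTop_of_mem {X : Type*} (L : (ℕ → X) → Set X)
    (hL : ∀ (σ : ℕ → X) (φ : ℕ → ℕ), StrictMono φ → L σ ⊆ L (σ ∘ φ))
    {σ : ℕ → X} {x : X} (hx : x ∈ L σ) :
    Filter.Tendsto σ Filter.atTop (@nhds X (derivedTop L hL) x) := by
  let _ := derivedTop L hL
  refine tendsto_nhds.2 fun U hU hxU => ?_
  by_contra hne
  obtain ⟨φ, hφ, hmem⟩ := Filter.extraction_of_frequently_atTop (Filter.not_eventually.1 hne)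
  exact hU (σ ∘ φ) hmem (hL σ φ hφ hx) hxU

/-- **Proposition.** Let `X` be a set endowed with a limit operator `L` and let `τ_L` be the
derived topology. Then (i) if `x ∈ L(σ)` then `σ` converges to `x` in `τ_L`, and (ii)
`(X, τ_L)` is a sequential space. -/
theorem derivedTop_conv_and_sequential
    {X : Type*} (L : (ℕ → X) → Set X)
    (hL : ∀ (σ : ℕ → X) (φ : ℕ → ℕ), StrictMono φ → L σ ⊆ L (σ ∘ φ)) :
    (∀ (σ : ℕ → X) (x : X), x ∈ L σ →
      Filter.Tendsto σ Filter.atTop (@nhds X (derivedTop L hL) x)) ∧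
    @SequentialSpace X (derivedTop L hL) := by
  refine ⟨fun σ x hx => tendsto_derivedTop_of_mem L hL hx, ?_⟩
  let _ := derivedTop L hL
  refine ⟨fun C hC => ⟨fun σ hσ x hx => ?_⟩⟩
  rw [compl_compl] at hσ ⊢
  exact hC hσ (tendsto_derivedTop_of_mem L hL hx)
end
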